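/- Suppose a ∈ [1/2, 1), L satisfies Assumptions A1 and A2, π_{2n} satisfies (C3), Assumption 2 holds, p_n ∝ n^{−ε} for some ε ∈ (0,1], and log(1/α_n) = log n − (1/2) log log n + c_n where c_n → ∞ and c_n = o(log log n). Then for any fixed η ∈ (0,1), δ ∈ (0,1) and ρ > 2/(η(1−δ)), the Bayes risk of the full Bayes rule satisfies R^{FB}_{OG} ≤ n p_n [2Φ(√(aρC/ε)) − 1](1 + o(1)) as n → ∞, where Φ is the standard normal cdf. -/

import Mathlib

open MeasureTheory ProbabilityTheory Real Filter Set

noncomputable section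

namespace PaperGL

/-- Posterior density kernel of the shrinkage coefficient `κ` given `(x, τ)`:
`π(κ | x, τ) ∝ κ^(a-1/2) (1-κ)^(-a-1) L(τ⁻²(κ⁻¹-1)) exp((1-κ)x²/2)` on `(0,1)`. -/
def kdens (a : ℝ) (L : ℝ → ℝ) (x τ κ : ℝ) : ℝ :=
  κ ^ (a - 1/2) * (1 - κ) ^ (-a - 1) * L ((1/τ^2) * (1/κ - 1)) * Real.exp ((1 - κ) * x^2 / 2)

/-- Posterior expectation of `g(κ)` given `(x, τ)`. -/
def kExp (a : ℝ) (L : ℝ → ℝ) (x τ : ℝ) (g : ℝ → ℝ) : ℝ :=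
  (∫ κ in Set.Ioo (0:ℝ) 1, g κ * kdens a L x τ κ) /
    (∫ κ in Set.Ioo (0:ℝ) 1, kdens a L x τ κ)

/-- `E(1−κ | x, τ)`. -/
def E1mK (a : ℝ) (L : ℝ → ℝ) (x τ : ℝ) : ℝ := kExp a L x τ (fun κ => 1 - κ)

/-- Posterior mean `T_τ(x) = x · E(1−κ | x, τ)`. -/
def postMean (a : ℝ) (L : ℝ → ℝ) (τ x : ℝ) : ℝ := x * E1mK a L x τ

/-- Posterior variance `Var(θ | x, τ)` of the mixture over `κ` of `N((1−κ)x, 1−κ)`. -/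
def postVar (a : ℝ) (L : ℝ → ℝ) (x τ : ℝ) : ℝ :=
  E1mK a L x τ + x^2 * (kExp a L x τ (fun κ => (1 - κ)^2) - (E1mK a L x τ)^2)

/-- `E(1−κ | x, τ)` in the `t = τ⁻²(κ⁻¹−1)` parametrisation. -/
def E1mKt (a : ℝ) (L : ℝ → ℝ) (x τ : ℝ) : ℝ :=
  (τ^2 * ∫ t in Set.Ioi (0:ℝ),
      (1 + t*τ^2) ^ (-(3:ℝ)/2) * t ^ (-a) * L t * Real.exp ((x^2/2) * (t*τ^2/(1+t*τ^2)))) /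
  (∫ t in Set.Ioi (0:ℝ),
      (1 + t*τ^2) ^ (-(1:ℝ)/2) * t ^ (-a-1) * L t * Real.exp ((x^2/2) * (t*τ^2/(1+t*τ^2))))

/-- The empirical Bayes estimate `τ̂` of the global shrinkage parameter. -/
def tauHat (c1 c2 : ℝ) (n : ℕ) (x : Fin n → ℝ) : ℝ :=
  max (1/(n:ℝ)) ((1/(c2*n)) * ∑ i, if Real.sqrt (c1 * Real.log n) < |x i| then (1:ℝ) else 0)

/-- Nearly black vectors: `θ ∈ ℓ₀[q]`. -/
def sparse (n q : ℕ) (θ : Fin n → ℝ) : Prop := Nat.card {i : Fin n // θ i ≠ 0} ≤ q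

/-- The sampling distribution `N_n(θ₀, I_n)`. -/
def Pmeas (n : ℕ) (θ0 : Fin n → ℝ) : Measure (Fin n → ℝ) :=
  Measure.pi fun i => gaussianReal (θ0 i) 1

/-- `q_n ∝ n^β` (two-sided proportionality). -/
def propTo (q : ℕ → ℕ) (β : ℝ) : Prop :=
  ∃ k1 k2 : ℝ, 0 < k1 ∧ 0 < k2 ∧
    ∀ᶠ n : ℕ in atTop, k1 * (n:ℝ)^β ≤ (q n : ℝ) ∧ (q n : ℝ) ≤ k2 * (n:ℝ)^β

/-- `p_n ∝ n^(-e)` for a real sequence. -/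
def propToR (p : ℕ → ℝ) (β : ℝ) : Prop :=
  ∃ k1 k2 : ℝ, 0 < k1 ∧ 0 < k2 ∧
    ∀ᶠ n : ℕ in atTop, k1 * (n:ℝ)^β ≤ p n ∧ p n ≤ k2 * (n:ℝ)^β

/-- Assumptions (A1) and (A2) on the slowly varying function `L`, together with
positivity, measurability. -/
def AssumpL (L : ℝ → ℝ) (Mb c0 t0 : ℝ) : Prop :=
  Measurable L ∧ (∀ t, 0 < t → 0 < L t) ∧ (∀ t, 0 < t → L t ≤ Mb) ∧
    0 < c0 ∧ 0 < t0 ∧ ∀ t, t0 ≤ t → c0 ≤ L t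

/-- Integrability of `t^(−a−1) L t` on `(0,∞)` with positive integral, and `K` its inverse. -/
def Kcond (a : ℝ) (L : ℝ → ℝ) (K : ℝ) : Prop :=
  MeasureTheory.IntegrableOn (fun t => t ^ (-a-1) * L t) (Set.Ioi (0:ℝ)) ∧
    0 < ∫ t in Set.Ioi (0:ℝ), t ^ (-a-1) * L t ∧
    K = (∫ t in Set.Ioi (0:ℝ), t ^ (-a-1) * L t)⁻¹

/-- The κ-posterior as a probability measure on `(0,1)`. -/
def kPostMeasure (a : ℝ) (L : ℝ → ℝ) (x τ : ℝ) : Measure ℝ :=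
  (∫⁻ κ in Set.Ioo (0:ℝ) 1, ENNReal.ofReal (kdens a L x τ κ))⁻¹ •
    ((volume.restrict (Set.Ioo (0:ℝ) 1)).withDensity fun κ => ENNReal.ofReal (kdens a L x τ κ))

/-- The posterior distribution of `θ` given `(x, τ)`: mixture over `κ` of `N((1−κ)x, 1−κ)`. -/
def thetaPost (a : ℝ) (L : ℝ → ℝ) (x τ : ℝ) : Measure ℝ :=
  (kPostMeasure a L x τ).bind fun κ => gaussianReal ((1-κ)*x) (Real.toNNReal (1-κ))

/-- `Π_τ(· | X)`: the posterior of the vector `θ` given `(X, τ)`. -/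
def PiTau (a : ℝ) (L : ℝ → ℝ) (n : ℕ) (X : Fin n → ℝ) (τ : ℝ) : Measure (Fin n → ℝ) :=
  Measure.pi fun i => thetaPost a L (X i) τ

/-- Marginal density `m(x, τ)` of one observation given `τ` (mixing over `l = λ²`). -/
def marg (a K : ℝ) (L : ℝ → ℝ) (x τ : ℝ) : ℝ :=
  ∫ l in Set.Ioi (0:ℝ), K * l ^ (-a-1) * L l *
    ((Real.sqrt (2 * Real.pi * (1 + l * τ^2)))⁻¹ * Real.exp (-(x^2) / (2 * (1 + l * τ^2))))

/-- Posterior density of `τ` given `X`, for a prior `π2` supported on `[lo, hi]`. -/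
def tauWeight (a K : ℝ) (L : ℝ → ℝ) (π2 : ℝ → ℝ) (lo hi : ℝ) (n : ℕ)
    (X : Fin n → ℝ) (τ : ℝ) : ℝ :=
  (π2 τ * ∏ i, marg a K L (X i) τ) /
    ∫ s in Set.Icc lo hi, π2 s * ∏ i, marg a K L (X i) s

/-- Full Bayes posterior mean `θ̂_i = ∫ T_τ(X_i) π_{2n}(τ|X) dτ`. -/
def fbMean (a K : ℝ) (L : ℝ → ℝ) (π2 : ℝ → ℝ) (n : ℕ) (X : Fin n → ℝ) (i : Fin n) : ℝ :=
  ∫ τ in Set.Icc ((n:ℝ)⁻¹) 1, postMean a L τ (X i) * tauWeight a K L π2 ((n:ℝ)⁻¹) 1 n X τ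

/-- Full Bayes posterior variance `Var(θ_i | X)`. -/
def fbVar (a K : ℝ) (L : ℝ → ℝ) (π2 : ℝ → ℝ) (n : ℕ) (X : Fin n → ℝ) (i : Fin n) : ℝ :=
  (∫ τ in Set.Icc ((n:ℝ)⁻¹) 1,
      (postVar a L (X i) τ + (postMean a L τ (X i))^2) * tauWeight a K L π2 ((n:ℝ)⁻¹) 1 n X τ)
    - (fbMean a K L π2 n X i)^2

/-- The posterior distribution of `τ` given `X`, as a measure on `[lo, hi]`. -/
def tauPostMeasure (a K : ℝ) (L : ℝ → ℝ) (π2 : ℝ → ℝ) (lo hi : ℝ) (n : ℕ)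
    (X : Fin n → ℝ) : Measure ℝ :=
  (∫⁻ τ in Set.Icc lo hi, ENNReal.ofReal (π2 τ * ∏ i, marg a K L (X i) τ))⁻¹ •
    ((volume.restrict (Set.Icc lo hi)).withDensity
      fun τ => ENNReal.ofReal (π2 τ * ∏ i, marg a K L (X i) τ))

/-- The full Bayes posterior `Π(· | X)` of `θ` given `X`. -/
def PiFull (a K : ℝ) (L : ℝ → ℝ) (π2 : ℝ → ℝ) (n : ℕ) (X : Fin n → ℝ) :
    Measure (Fin n → ℝ) :=
  (tauPostMeasure a K L π2 ((n:ℝ)⁻¹) 1 n X).bind fun τ => PiTau a L n X τ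

/-- Condition (C1): `π_{2n}` is a density supported on `[1/n, 1]`. -/
def CondC1 (π2 : ℕ → ℝ → ℝ) : Prop :=
  (∀ (n : ℕ) (τ : ℝ), 0 ≤ π2 n τ) ∧ (∀ (n : ℕ) (τ : ℝ), τ ∉ Set.Icc ((n:ℝ)⁻¹) 1 → π2 n τ = 0) ∧
    ∀ n : ℕ, 1 ≤ n → ∫ τ in Set.Icc ((n:ℝ)⁻¹) 1, π2 n τ = 1

/-- `t_n = C_u π^{3/2} (q_n/n) √(log(n/q_n))`. -/
def tseq (Cu : ℝ) (q : ℕ → ℕ) (n : ℕ) : ℝ :=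
  Cu * Real.pi ^ ((3:ℝ)/2) * ((q n : ℝ)/n) * Real.sqrt (Real.log ((n:ℝ)/(q n)))

/-- Condition (C2). -/
def CondC2 (π2 : ℕ → ℝ → ℝ) (q : ℕ → ℕ) : Prop :=
  ∃ Cu c M1 K' : ℝ, 0 < Cu ∧ c ≤ Cu/2 ∧ 1 ≤ M1 ∧ 0 < K' ∧
    ∀ᶠ n : ℕ in atTop,
      K' * Real.exp (-c * q n) ≤
        ((q n : ℝ)/n)^M1 * ∫ τ in Set.Icc (tseq Cu q n / 2) (tseq Cu q n), π2 n τ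

/-- Full Bayes posterior shrinkage weight `E(1−κ_i | X)`. -/
def fbShrink (a K : ℝ) (L : ℝ → ℝ) (π2 : ℝ → ℝ) (lo hi : ℝ) (n : ℕ)
    (X : Fin n → ℝ) (i : Fin n) : ℝ :=
  ∫ τ in Set.Icc lo hi, E1mK a L (X i) τ * tauWeight a K L π2 lo hi n X τ

/-- Marginal two-groups distribution of one observation:
`(1−p) N(0,1) + p N(0, 1+ψ²)` with `u = ψ²`. -/
def mixM (p u : ℝ) : Measure ℝ :=
  ENNReal.ofReal (1 - p) • gaussianReal 0 1 +
    ENNReal.ofReal p • gaussianReal 0 (Real.toNNReal (1 + u))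

/-- Joint law of `X` given `ν_i = 0`. -/
def nullMeas (n : ℕ) (i : Fin n) (p u : ℝ) : Measure (Fin n → ℝ) :=
  Measure.pi fun j => if j = i then gaussianReal 0 1 else mixM p u

/-- Joint law of `X` given `ν_i = 1`. -/
def altMeas (n : ℕ) (i : Fin n) (p u : ℝ) : Measure (Fin n → ℝ) :=
  Measure.pi fun j => if j = i then gaussianReal 0 (Real.toNNReal (1 + u)) else mixM p u

/-- Type I error `t^{FB}_{1i}` of the full Bayes rule. -/
def t1FB (a K : ℝ) (L : ℝ → ℝ) (π2 : ℕ → ℝ → ℝ) (α : ℕ → ℝ) (p u : ℕ → ℝ)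
    (n : ℕ) (i : Fin n) : ℝ :=
  ((nullMeas n i (p n) (u n))
    {x | 1/2 < fbShrink a K L (π2 n) ((n:ℝ)⁻¹) (α n) n x i}).toReal

/-- Type II error `t^{FB}_{2i}` of the full Bayes rule. -/
def t2FB (a K : ℝ) (L : ℝ → ℝ) (π2 : ℕ → ℝ → ℝ) (α : ℕ → ℝ) (p u : ℕ → ℝ)
    (n : ℕ) (i : Fin n) : ℝ :=
  ((altMeas n i (p n) (u n))
    {x | fbShrink a K L (π2 n) ((n:ℝ)⁻¹) (α n) n x i ≤ 1/2}).toReal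

/-- Bayes risk `R^{FB}_{OG}` of the full Bayes rule. -/
def RFB (a K : ℝ) (L : ℝ → ℝ) (π2 : ℕ → ℝ → ℝ) (α : ℕ → ℝ) (p u : ℕ → ℝ) (n : ℕ) : ℝ :=
  ∑ i : Fin n, ((1 - p n) * t1FB a K L π2 α p u n i + p n * t2FB a K L π2 α p u n i)

/-- Condition (C3): `π_{2n}` is a density supported on `[1/n, α_n]`,
with `α_n → 0` and `n α_n → ∞`. -/
def CondC3 (π2 : ℕ → ℝ → ℝ) (α : ℕ → ℝ) : Prop :=
  (∀ (n : ℕ) (τ : ℝ), 0 ≤ π2 n τ) ∧ (∀ (n : ℕ) (τ : ℝ), τ ∉ Set.Icc ((n:ℝ)⁻¹) (α n) → π2 n τ = 0) ∧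
    (∀ n : ℕ, 1 ≤ n → ∫ τ in Set.Icc ((n:ℝ)⁻¹) (α n), π2 n τ = 1) ∧
    Tendsto α atTop (nhds 0) ∧ Tendsto (fun n : ℕ => (n:ℝ) * α n) atTop atTop

/-- Assumption 2 of Bogdan et al.: `p_n → 0`, `u_n = ψ_n² → ∞`,
`log v_n / u_n → C ∈ (0,∞)` with `v_n = u_n f_n²`, `f_n = (1-p_n)/p_n`. -/
def Assump2 (p u : ℕ → ℝ) (C : ℝ) : Prop :=
  Tendsto p atTop (nhds 0) ∧ Tendsto u atTop atTop ∧ 0 < C ∧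
    Tendsto (fun n => Real.log (u n * ((1 - p n)/p n)^2) / u n) atTop (nhds C)

/-- Standard normal cdf. -/
def Phi (z : ℝ) : ℝ := ((gaussianReal 0 1) (Set.Iic z)).toReal

/-- Squared threshold of the Bayes Oracle. -/
def csq (p u : ℕ → ℝ) (n : ℕ) : ℝ :=
  ((1 + u n)/u n) * (Real.log (1 + u n) + 2 * Real.log ((1 - p n)/p n))

/-- Type I error of the Bayes Oracle. -/
def t1BO (p u : ℕ → ℝ) (n : ℕ) : ℝ :=
  ((gaussianReal 0 1) {x : ℝ | csq p u n < x^2}).toReal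

/-- Type II error of the Bayes Oracle. -/
def t2BO (p u : ℕ → ℝ) (n : ℕ) : ℝ :=
  ((gaussianReal 0 (Real.toNNReal (1 + u n))) {x : ℝ | x^2 ≤ csq p u n}).toReal

/-- Bayes risk of the Bayes Oracle. -/
def RBO (p u : ℕ → ℝ) (n : ℕ) : ℝ :=
  (n:ℝ) * ((1 - p n) * t1BO p u n + p n * t2BO p u n)

end PaperGL

namespace PaperGL

/-- The substitution `t = s⁻¹(κ⁻¹ - 1)` turns the singular part of the posterior kernel into
the prior kernel `t^(-a-1) L t`. -/
lemma integrableOn_singular_and_integral_le {a : ℝ} (ha : a < 1) {L : ℝ → ℝ}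
    (hLm : Measurable L) (hL0 : ∀ t, 0 < t → 0 < L t)
    (hI : IntegrableOn (fun t => t ^ (-a - 1) * L t) (Ioi (0 : ℝ))) {s : ℝ} (hs : 0 < s) :
    IntegrableOn (fun κ => (1 - κ) ^ (-a - 1) * L ((1 / s) * (1 / κ - 1))) (Ioo (0 : ℝ) 1) ∧
    ∫ κ in Ioo (0 : ℝ) 1, (1 - κ) ^ (-a - 1) * L ((1 / s) * (1 / κ - 1)) ≤
      s ^ (-a) * ∫ t in Ioi (0 : ℝ), t ^ (-a - 1) * L t := by
  set g : ℝ → ℝ := fun κ => (1 - κ) ^ (-a - 1) * L ((1 / s) * (1 / κ - 1)) with hg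
  set f : ℝ → ℝ := fun t => (1 + t * s)⁻¹ with hf
  set f' : ℝ → ℝ := fun t => -s / (1 + t * s) ^ 2 with hf'
  have hpos : ∀ t ∈ Ioi (0 : ℝ), 1 < 1 + t * s := fun t ht => by
    have : 0 < t * s := mul_pos ht hs
    linarith
  have himg : f '' Ioi (0 : ℝ) = Ioo (0 : ℝ) 1 := by
    ext κ
    constructor
    · rintro ⟨t, ht, rfl⟩
      have h1 := hpos t ht
      exact ⟨inv_pos.2 (by linarith), inv_lt_one_of_one_lt₀ h1⟩
    · rintro ⟨h0, h1⟩
      refine ⟨(1 / s) * (1 / κ - 1), ?_, ?_⟩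
      · have : 1 < 1 / κ := (one_lt_div h0).2 h1
        exact mul_pos (one_div_pos.2 hs) (sub_pos.2 this)
      · simp only [hf]
        field_simp
        ring
  have hder : ∀ t ∈ Ioi (0 : ℝ), HasDerivWithinAt f (f' t) (Ioi 0) t := by
    intro t ht
    have h1 := hpos t ht
    have h2 : HasDerivAt (fun t : ℝ => 1 + t * s) s t := by
      simpa using ((hasDerivAt_id t).mul_const s).const_add 1
    exact (h2.inv (by linarith)).hasDerivWithinAt
  have hinj : InjOn f (Ioi (0 : ℝ)) := by
    intro t ht t' ht' h
    have h3 : 1 + t * s = 1 + t' * s := inv_injective h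
    have h4 : t * s = t' * s := by linarith
    exact mul_right_cancel₀ hs.ne' h4
  have hcomp : ∀ t ∈ Ioi (0 : ℝ), |f' t| • g (f t) =
      s ^ (-a) * ((1 + t * s) ^ (a - 1) * (t ^ (-a - 1) * L t)) := by
    intro t ht
    have ht0 : 0 < t := ht
    have h1 : 0 < 1 + t * s := by linarith [hpos t ht]
    have e1 : 1 - f t = t * s * (1 + t * s)⁻¹ := by
      simp only [hf]; field_simp; ring
    have e2 : (1 / s) * (1 / f t - 1) = t := by
      simp only [hf, one_div, inv_inv]; field_simp; ring
    have e3 : |f' t| = s * (1 + t * s) ^ (-2 : ℝ) := by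
      simp only [hf']
      rw [neg_div, abs_neg, abs_of_pos (by positivity), Real.rpow_neg h1.le]
      norm_num [div_eq_mul_inv]
    have e4 : (1 + t * s) ^ (a - 1) = (1 + t * s) ^ (-2 : ℝ) * (1 + t * s) ^ (a + 1) := by
      rw [← Real.rpow_add h1]; congr 1; ring
    have e5 : ((1 + t * s)⁻¹) ^ (-a - 1) = (1 + t * s) ^ (a + 1) := by
      rw [Real.inv_rpow h1.le, ← Real.rpow_neg h1.le]; congr 1; ring
    have e6 : s ^ (-a) = s * s ^ (-a - 1) := by
      rw [Real.rpow_sub_one hs.ne']; field_simp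
    simp only [hg, smul_eq_mul]
    rw [e1, e2, e3, Real.mul_rpow (by positivity) (by positivity), Real.mul_rpow ht0.le hs.le,
      e4, e5, e6]
    ring
  have hle : ∀ t ∈ Ioi (0 : ℝ),
      s ^ (-a) * ((1 + t * s) ^ (a - 1) * (t ^ (-a - 1) * L t)) ≤
        s ^ (-a) * (t ^ (-a - 1) * L t) := by
    intro t ht
    have ht0 : 0 < t := ht
    have := hL0 t ht
    have h1 : (1 + t * s) ^ (a - 1) ≤ 1 :=
      Real.rpow_le_one_of_one_le_of_nonpos (hpos t ht).le (by linarith)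
    have h2 : 0 ≤ t ^ (-a - 1) * L t := by positivity
    exact mul_le_mul_of_nonneg_left (mul_le_of_le_one_left h2 h1) (by positivity)
  have hfint : IntegrableOn (fun t => s ^ (-a) * ((1 + t * s) ^ (a - 1) * (t ^ (-a - 1) * L t)))
      (Ioi (0 : ℝ)) := by
    refine (hI.const_mul (s ^ (-a))).mono' (by fun_prop) ?_
    filter_upwards [ae_restrict_mem measurableSet_Ioi] with t ht
    have ht0 : 0 < t := ht
    have := hL0 t ht
    have h1 := hpos t ht
    rw [Real.norm_of_nonneg (by positivity)]
    exact hle t ht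
  constructor
  · rw [← himg, integrableOn_image_iff_integrableOn_abs_deriv_smul measurableSet_Ioi hder hinj]
    exact hfint.congr_fun (fun t ht => (hcomp t ht).symm) measurableSet_Ioi
  · rw [← himg, integral_image_eq_integral_abs_deriv_smul measurableSet_Ioi hder hinj,
      setIntegral_congr_fun measurableSet_Ioi hcomp, ← integral_const_mul]
    exact setIntegral_mono_on hfint (hI.const_mul _) measurableSet_Ioi hle

lemma measurable_kdens_uncurry (a : ℝ) {L : ℝ → ℝ} (hLm : Measurable L) (x : ℝ) :
    Measurable (Function.uncurry fun τ κ => kdens a L x τ κ) := by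
  unfold kdens Function.uncurry
  fun_prop

lemma measurable_kdens (a : ℝ) {L : ℝ → ℝ} (hLm : Measurable L) (x τ : ℝ) :
    Measurable (kdens a L x τ) :=
  (measurable_kdens_uncurry a hLm x).of_uncurry_left

lemma kdens_arg_pos {τ κ : ℝ} (hτ : 0 < τ) (hκ : κ ∈ Ioo (0 : ℝ) 1) :
    0 < (1 / τ ^ 2) * (1 / κ - 1) := by
  have : 1 < 1 / κ := (one_lt_div hκ.1).2 hκ.2
  exact mul_pos (by positivity) (by linarith)

lemma kdens_pos {a : ℝ} {L : ℝ → ℝ} (hL0 : ∀ t, 0 < t → 0 < L t) {x τ κ : ℝ} (hτ : 0 < τ)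
    (hκ : κ ∈ Ioo (0 : ℝ) 1) : 0 < kdens a L x τ κ := by
  have h1 := hL0 _ (kdens_arg_pos hτ hκ)
  have h2 : 0 < 1 - κ := sub_pos.2 hκ.2
  have h3 := hκ.1
  unfold kdens
  positivity

lemma kdens_le {a : ℝ} (ha : 1 / 2 ≤ a) {L : ℝ → ℝ} (hL0 : ∀ t, 0 < t → 0 < L t)
    {x τ κ b : ℝ} (hτ : 0 < τ) (hκ : κ ∈ Ioo (0 : ℝ) 1) (hb : (1 - κ) * x ^ 2 / 2 ≤ b) :
    kdens a L x τ κ ≤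
      Real.exp b * ((1 - κ) ^ (-a - 1) * L ((1 / τ ^ 2) * (1 / κ - 1))) := by
  have h1 := hL0 _ (kdens_arg_pos hτ hκ)
  have h2 : 0 < 1 - κ := sub_pos.2 hκ.2
  have h3 : κ ^ (a - 1 / 2) ≤ 1 := Real.rpow_le_one hκ.1.le hκ.2.le (by linarith)
  have h4 := Real.exp_le_exp.2 hb
  have h5 : 0 ≤ (1 - κ) ^ (-a - 1) * L ((1 / τ ^ 2) * (1 / κ - 1)) := by positivity
  unfold kdens
  calc κ ^ (a - 1/2) * (1 - κ) ^ (-a - 1) * L ((1/τ^2) * (1/κ - 1)) *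
        Real.exp ((1 - κ) * x^2 / 2)
      = κ ^ (a - 1/2) * (((1 - κ) ^ (-a - 1) * L ((1/τ^2) * (1/κ - 1))) *
        Real.exp ((1 - κ) * x^2 / 2)) := by ring
    _ ≤ 1 * (((1 - κ) ^ (-a - 1) * L ((1/τ^2) * (1/κ - 1))) * Real.exp b) := by gcongr
    _ = _ := by ring

lemma half_sub_mul_sq_le {x κ c : ℝ} (hκ : c ≤ κ) :
    (1 - κ) * x ^ 2 / 2 ≤ (1 - c) * x ^ 2 / 2 := by
  have := mul_le_mul_of_nonneg_right (sub_le_sub_left hκ 1) (sq_nonneg x)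
  linarith

lemma integrableOn_kdens {a : ℝ} (ha : 1 / 2 ≤ a ∧ a < 1) {L : ℝ → ℝ}
    (hLm : Measurable L) (hL0 : ∀ t, 0 < t → 0 < L t)
    (hI : IntegrableOn (fun t => t ^ (-a - 1) * L t) (Ioi (0 : ℝ))) {τ : ℝ} (hτ : 0 < τ) (x : ℝ) :
    IntegrableOn (kdens a L x τ) (Ioo (0 : ℝ) 1) := by
  have h := (integrableOn_singular_and_integral_le ha.2 hLm hL0 hI (pow_pos hτ 2)).1
  refine (h.const_mul (Real.exp (x ^ 2 / 2))).mono'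
    (measurable_kdens a hLm x τ).aestronglyMeasurable ?_
  filter_upwards [ae_restrict_mem measurableSet_Ioo] with κ hκ
  rw [Real.norm_of_nonneg (kdens_pos hL0 hτ hκ).le]
  refine kdens_le ha.1 hL0 hτ hκ ?_
  simpa using half_sub_mul_sq_le (x := x) hκ.1.le

lemma integral_kdens_ge_of_subset {a : ℝ} (ha : 1 / 2 ≤ a ∧ a < 1) {L : ℝ → ℝ}
    (hLm : Measurable L) (hL0 : ∀ t, 0 < t → 0 < L t)
    (hI : IntegrableOn (fun t => t ^ (-a - 1) * L t) (Ioi (0 : ℝ))) {τ : ℝ} (hτ : 0 < τ) (x : ℝ)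
    {b c m : ℝ} (hbc : b ≤ c) (hb : 0 < b) (hc : c < 1)
    (hm : ∀ κ ∈ Icc b c, m ≤ kdens a L x τ κ) :
    (c - b) * m ≤ ∫ κ in Ioo (0 : ℝ) 1, kdens a L x τ κ := by
  have hfint := integrableOn_kdens ha hLm hL0 hI hτ x
  have hsub : Icc b c ⊆ Ioo (0 : ℝ) 1 := fun κ hκ => ⟨hb.trans_le hκ.1, hκ.2.trans_lt hc⟩
  calc (c - b) * m = ∫ _κ in Icc b c, m := by
        rw [setIntegral_const, smul_eq_mul, Measure.real, Real.volume_Icc,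
          ENNReal.toReal_ofReal (by linarith)]
    _ ≤ ∫ κ in Icc b c, kdens a L x τ κ :=
        setIntegral_mono_on (by simp) (hfint.mono_set hsub) measurableSet_Icc hm
    _ ≤ _ := by
        refine setIntegral_mono_set hfint ?_ hsub.eventuallyLE
        filter_upwards [ae_restrict_mem measurableSet_Ioo] with κ hκ
        exact (kdens_pos hL0 hτ hκ).le

lemma le_rpow_sub_half {a κ : ℝ} (ha : a < 1) (h0 : 0 < κ) (h1 : κ ≤ 1) :
    κ ≤ κ ^ (a - 1 / 2) := by
  simpa using Real.rpow_le_rpow_of_exponent_ge h0 h1 (show a - 1 / 2 ≤ 1 by linarith)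

/-- Lower bound for the normalising constant, exploiting the mass near `κ = 1`. -/
lemma integral_kdens_ge_rpow {a : ℝ} (ha : 1 / 2 ≤ a ∧ a < 1) {L : ℝ → ℝ}
    {Mb c0 t0 : ℝ} (hL : AssumpL L Mb c0 t0)
    (hI : IntegrableOn (fun t => t ^ (-a - 1) * L t) (Ioi (0 : ℝ))) {τ : ℝ} (hτ : 0 < τ)
    (hτ4 : t0 * τ ^ 2 ≤ 1 / 4) (x : ℝ) :
    c0 / 4 * (2 * (t0 * τ ^ 2)) ^ (-a) ≤ ∫ κ in Ioo (0 : ℝ) 1, kdens a L x τ κ := by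
  obtain ⟨hLm, hL0, -, hc0, ht0, hLc⟩ := hL
  set r := t0 * τ ^ 2 with hr
  have hr0 : 0 < r := by positivity
  have key := integral_kdens_ge_of_subset ha hLm hL0 hI hτ x (b := 1 - 2 * r) (c := 1 - r)
    (m := 1 / 2 * (2 * r) ^ (-a - 1) * c0 * 1) (by linarith) (by linarith) (by linarith) ?_
  · refine le_trans (le_of_eq ?_) key
    rw [show -a - 1 = -a + (-1) by ring, Real.rpow_add (by positivity), Real.rpow_neg_one]
    field_simp
    ring
  · rintro κ ⟨h1, h2⟩
    have hκ0 : 0 < κ := by linarith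
    have hκ1 : κ < 1 := by linarith
    have e1 : 1 / 2 ≤ κ ^ (a - 1 / 2) := by
      linarith [le_rpow_sub_half ha.2 hκ0 hκ1.le]
    have e2 : (2 * r) ^ (-a - 1) ≤ (1 - κ) ^ (-a - 1) :=
      Real.rpow_le_rpow_of_nonpos (by linarith) (by linarith) (by linarith)
    have e3 : c0 ≤ L ((1 / τ ^ 2) * (1 / κ - 1)) := by
      apply hLc
      have : r ≤ 1 / κ - 1 := by
        rw [le_sub_iff_add_le, le_div_iff₀ hκ0]
        nlinarith
      calc t0 = (1 / τ ^ 2) * r := by rw [hr]; field_simp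
        _ ≤ _ := by gcongr
    have e4 : 1 ≤ Real.exp ((1 - κ) * x ^ 2 / 2) :=
      Real.one_le_exp (by have : 0 ≤ 1 - κ := by linarith
                          positivity)
    have e5 : 0 ≤ L ((1 / τ ^ 2) * (1 / κ - 1)) := hc0.le.trans e3
    have e6 : 0 ≤ (1 - κ) ^ (-a - 1) := Real.rpow_nonneg (by linarith) _
    unfold kdens
    gcongr

/-- Lower bound for the normalising constant, exploiting the mass near `κ = 0`. -/
lemma integral_kdens_ge_exp {a : ℝ} (ha : 1 / 2 ≤ a ∧ a < 1) {L : ℝ → ℝ}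
    {Mb c0 t0 : ℝ} (hL : AssumpL L Mb c0 t0)
    (hI : IntegrableOn (fun t => t ^ (-a - 1) * L t) (Ioi (0 : ℝ))) {τ : ℝ} (hτ : 0 < τ)
    (hτ4 : t0 * τ ^ 2 ≤ 1 / 4) (x : ℝ) {d : ℝ} (hd : 0 < d) (hd2 : d ≤ 1 / 2) :
    d ^ 2 / 4 * c0 * Real.exp ((1 - d) * x ^ 2 / 2) ≤
      ∫ κ in Ioo (0 : ℝ) 1, kdens a L x τ κ := by
  obtain ⟨hLm, hL0, -, hc0, ht0, hLc⟩ := hL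
  have key := integral_kdens_ge_of_subset ha hLm hL0 hI hτ x (b := d / 2) (c := d)
    (m := d / 2 * 1 * c0 * Real.exp ((1 - d) * x ^ 2 / 2)) (by linarith) (by linarith)
    (by linarith) ?_
  · refine le_trans (le_of_eq ?_) key
    ring
  · rintro κ ⟨h1, h2⟩
    have hκ0 : 0 < κ := by linarith
    have hκ1 : κ < 1 := by linarith
    have e1 : d / 2 ≤ κ ^ (a - 1 / 2) := by
      linarith [le_rpow_sub_half ha.2 hκ0 hκ1.le]
    have e2 : 1 ≤ (1 - κ) ^ (-a - 1) :=
      Real.one_le_rpow_of_pos_of_le_one_of_nonpos (by linarith) (by linarith) (by linarith)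
    have e3 : c0 ≤ L ((1 / τ ^ 2) * (1 / κ - 1)) := by
      apply hLc
      have : 1 ≤ 1 / κ - 1 := by
        rw [le_sub_iff_add_le, le_div_iff₀ hκ0]
        linarith
      calc t0 = (1 / τ ^ 2) * (t0 * τ ^ 2) := by field_simp
        _ ≤ _ := by gcongr; linarith
    have e4 : Real.exp ((1 - d) * x ^ 2 / 2) ≤ Real.exp ((1 - κ) * x ^ 2 / 2) :=
      Real.exp_le_exp.2 (half_sub_mul_sq_le h2)
    have e5 : 0 ≤ L ((1 / τ ^ 2) * (1 / κ - 1)) := hc0.le.trans e3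
    have e6 : 0 ≤ (1 - κ) ^ (-a - 1) := Real.rpow_nonneg (by linarith) _
    unfold kdens
    gcongr

lemma integrableOn_one_sub_rpow {a : ℝ} (ha : a < 1) :
    IntegrableOn (fun κ : ℝ => (1 - κ) ^ (-a)) (Ioo (0 : ℝ) 1) := by
  have h : IntervalIntegrable (fun κ : ℝ => κ ^ (-a)) volume 0 1 :=
    intervalIntegral.intervalIntegrable_rpow' (by linarith)
  have h2 := (h.comp_sub_left 1).symm
  simp only [sub_self, sub_zero] at h2
  rwa [intervalIntegrable_iff_integrableOn_Ioo_of_le zero_le_one] at h2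

/-- `E(1 - κ | x, τ) = O(e^{x²/2} τ^{2a})`, uniformly in `x`, for small `τ`. -/
lemma exists_E1mK_le {a : ℝ} (ha : 1 / 2 ≤ a ∧ a < 1) {L : ℝ → ℝ}
    {Mb c0 t0 : ℝ} (hL : AssumpL L Mb c0 t0)
    (hI : IntegrableOn (fun t => t ^ (-a - 1) * L t) (Ioi (0 : ℝ))) :
    ∃ A : ℝ, 0 < A ∧ ∀ τ x : ℝ, 0 < τ → t0 * τ ^ 2 ≤ 1 / 4 →
      E1mK a L x τ ≤ A * Real.exp (x ^ 2 / 2) * τ ^ (2 * a) := by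
  have hL' := hL
  obtain ⟨hLm, hL0, hLM, hc0, ht0, hLc⟩ := hL
  have hM : 0 < Mb := (hL0 1 one_pos).trans_le (hLM 1 one_pos)
  set J : ℝ := ∫ κ in Ioo (0 : ℝ) 1, (1 - κ) ^ (-a) with hJ
  have hJ0 : 0 ≤ J := by
    refine setIntegral_nonneg measurableSet_Ioo fun κ hκ => ?_
    exact Real.rpow_nonneg (sub_nonneg.2 hκ.2.le) _
  refine ⟨Mb * (J + 1) * 4 / c0 * (2 * t0) ^ a, by positivity, fun τ x hτ hτ4 => ?_⟩
  have hD := integral_kdens_ge_rpow ha hL' hI hτ hτ4 x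
  set D := ∫ κ in Ioo (0 : ℝ) 1, kdens a L x τ κ
  have hDpos : 0 < D := lt_of_lt_of_le (by positivity) hD
  have hnum : ∫ κ in Ioo (0 : ℝ) 1, (1 - κ) * kdens a L x τ κ ≤
      (Mb * Real.exp (x ^ 2 / 2)) * J := by
    rw [hJ, ← integral_const_mul]
    refine integral_mono_of_nonneg ?_ ((integrableOn_one_sub_rpow ha.2).const_mul _) ?_
    · filter_upwards [ae_restrict_mem measurableSet_Ioo] with κ hκ
      exact mul_nonneg (sub_nonneg.2 hκ.2.le) (kdens_pos hL0 hτ hκ).le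
    · filter_upwards [ae_restrict_mem measurableSet_Ioo] with κ hκ
      have h1 : 0 < 1 - κ := sub_pos.2 hκ.2
      have h2 := kdens_le ha.1 hL0 (x := x) hτ hκ (b := x ^ 2 / 2)
        (by simpa using half_sub_mul_sq_le (x := x) hκ.1.le)
      have h3 := hLM _ (kdens_arg_pos hτ hκ)
      calc (1 - κ) * kdens a L x τ κ
          ≤ (1 - κ) * (Real.exp (x ^ 2 / 2) * ((1 - κ) ^ (-a - 1) * Mb)) := by
            refine mul_le_mul_of_nonneg_left (h2.trans ?_) h1.le
            gcongr
        _ = _ := by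
            rw [Real.rpow_sub_one h1.ne']
            field_simp
  have hpow : (2 * (t0 * τ ^ 2)) ^ a = (2 * t0) ^ a * τ ^ (2 * a) := by
    rw [← mul_assoc, Real.mul_rpow (by positivity) (by positivity), ← Real.rpow_natCast,
      ← Real.rpow_mul hτ.le]
    norm_num
  unfold E1mK kExp
  rw [div_le_iff₀ hDpos]
  have hkey : Mb * Real.exp (x ^ 2 / 2) * (J + 1) =
      (Mb * (J + 1) * 4 / c0 * (2 * t0) ^ a) * Real.exp (x ^ 2 / 2) * τ ^ (2 * a) *
        (c0 / 4 * (2 * (t0 * τ ^ 2)) ^ (-a)) := by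
    rw [Real.rpow_neg (by positivity), hpow]
    field_simp
  calc _ ≤ Mb * Real.exp (x ^ 2 / 2) * J := hnum
    _ ≤ Mb * Real.exp (x ^ 2 / 2) * (J + 1) := by gcongr; linarith
    _ = _ := hkey
    _ ≤ _ := by gcongr

/-- `E(κ | x, τ) ≤ 1/4 + O(e^{-x²/16} + e^{-(η-d)x²/2} τ^{-2a})` for small `τ`. -/
lemma exists_E1mK_ge {a : ℝ} (ha : 1 / 2 ≤ a ∧ a < 1) {L : ℝ → ℝ}
    {Mb c0 t0 : ℝ} (hL : AssumpL L Mb c0 t0)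
    (hI : IntegrableOn (fun t => t ^ (-a - 1) * L t) (Ioi (0 : ℝ)))
    {η d : ℝ} (hη1 : η < 1) (hd : 0 < d) (hd8 : d ≤ 1 / 8) :
    ∃ B : ℝ, 0 < B ∧ ∀ τ x : ℝ, 0 < τ → t0 * τ ^ 2 ≤ 1 / 4 →
      3 / 4 - B * (Real.exp (-x ^ 2 / 16) +
        Real.exp (-(η - d) * x ^ 2 / 2) * (τ ^ 2) ^ (-a)) ≤ E1mK a L x τ := by
  have hL' := hL
  obtain ⟨hLm, hL0, hLM, hc0, ht0, hLc⟩ := hL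
  have hM : 0 < Mb := (hL0 1 one_pos).trans_le (hLM 1 one_pos)
  set I := ∫ t in Ioi (0 : ℝ), t ^ (-a - 1) * L t with hIdef
  have hI0 : 0 ≤ I := by
    refine setIntegral_nonneg measurableSet_Ioi fun t (ht : 0 < t) => ?_
    have := hL0 t ht
    positivity
  have hη' : 0 < 1 - η := sub_pos.2 hη1
  set A := (1 - η) ^ (-a - 1) * Mb with hA
  have hA0 : 0 < A := by positivity
  set c := d ^ 2 / 4 * c0 with hc
  have hcpos : 0 < c := by positivity
  refine ⟨(A + I) / c, by positivity, fun τ x hτ hτ4 => ?_⟩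
  have hD := integral_kdens_ge_exp ha hL' hI hτ hτ4 x hd (by linarith)
  have hfint := integrableOn_kdens ha hLm hL0 hI hτ x
  obtain ⟨hsint, hsle⟩ := integrableOn_singular_and_integral_le ha.2 hLm hL0 hI (pow_pos hτ 2)
  set D := ∫ κ in Ioo (0 : ℝ) 1, kdens a L x τ κ with hDdef
  have hDpos : 0 < D := lt_of_lt_of_le (by positivity) hD
  have hκint : IntegrableOn (fun κ => κ * kdens a L x τ κ) (Ioo (0 : ℝ) 1) := by
    refine hfint.mono' (measurable_id.mul (measurable_kdens a hLm x τ)).aestronglyMeasurable ?_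
    filter_upwards [ae_restrict_mem measurableSet_Ioo] with κ hκ
    have h := kdens_pos hL0 (x := x) (a := a) hτ hκ
    rw [Real.norm_of_nonneg (mul_nonneg hκ.1.le h.le)]
    exact mul_le_of_le_one_left h.le hκ.2.le
  have hnum : ∫ κ in Ioo (0 : ℝ) 1, (1 - κ) * kdens a L x τ κ =
      D - ∫ κ in Ioo (0 : ℝ) 1, κ * kdens a L x τ κ := by
    rw [hDdef, ← integral_sub hfint hκint]
    congr 1
    ext κ
    ring
  have hκ : ∫ κ in Ioo (0 : ℝ) 1, κ * kdens a L x τ κ ≤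
      1 / 4 * D + (A * Real.exp (3 / 8 * x ^ 2) +
        Real.exp ((1 - η) * x ^ 2 / 2) * ((τ ^ 2) ^ (-a) * I)) := by
    have hc1 : IntegrableOn (fun _ : ℝ => A * Real.exp (3 / 8 * x ^ 2)) (Ioo (0 : ℝ) 1) :=
      integrableOn_const (by simp)
    have hmono : ∫ κ in Ioo (0 : ℝ) 1, κ * kdens a L x τ κ ≤
        ∫ κ in Ioo (0 : ℝ) 1, (1 / 4 * kdens a L x τ κ + (A * Real.exp (3 / 8 * x ^ 2) +
          Real.exp ((1 - η) * x ^ 2 / 2) *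
            ((1 - κ) ^ (-a - 1) * L ((1 / τ ^ 2) * (1 / κ - 1))))) := by
      refine setIntegral_mono_on hκint
        ((hfint.const_mul _).add (hc1.add (hsint.const_mul _))) measurableSet_Ioo fun κ hκ => ?_
      have h := kdens_pos hL0 (x := x) (a := a) hτ hκ
      have h1 : 0 < 1 - κ := sub_pos.2 hκ.2
      have h2 := hL0 _ (kdens_arg_pos hτ hκ)
      have h3 := hLM _ (kdens_arg_pos hτ hκ)
      have h4 : 0 ≤ Real.exp ((1 - η) * x ^ 2 / 2) *
            ((1 - κ) ^ (-a - 1) * L ((1 / τ ^ 2) * (1 / κ - 1))) := by positivity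
      have h5 : 0 ≤ A * Real.exp (3 / 8 * x ^ 2) := by positivity
      have h6 : κ * kdens a L x τ κ ≤ kdens a L x τ κ := mul_le_of_le_one_left h.le hκ.2.le
      rcases le_total κ (1 / 4) with hq | hq
      · nlinarith
      rcases le_total κ η with hη | hη
      · have h7 := kdens_le ha.1 hL0 (x := x) hτ hκ (b := 3 / 8 * x ^ 2)
          (by linarith [half_sub_mul_sq_le (x := x) hq])
        have h8 : (1 - κ) ^ (-a - 1) ≤ (1 - η) ^ (-a - 1) :=
          Real.rpow_le_rpow_of_nonpos hη' (by linarith) (by linarith)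
        have h9 : Real.exp (3 / 8 * x ^ 2) *
            ((1 - κ) ^ (-a - 1) * L ((1 / τ ^ 2) * (1 / κ - 1))) ≤
            Real.exp (3 / 8 * x ^ 2) * ((1 - η) ^ (-a - 1) * Mb) := by gcongr
        linarith
      · have h7 := kdens_le ha.1 hL0 (x := x) hτ hκ (b := (1 - η) * x ^ 2 / 2)
          (half_sub_mul_sq_le (x := x) hη)
        linarith
    refine hmono.trans ?_
    have hc2 := hsint.const_mul (Real.exp ((1 - η) * x ^ 2 / 2))
    have hc3 : IntegrableOn (fun κ => A * Real.exp (3 / 8 * x ^ 2) +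
        Real.exp ((1 - η) * x ^ 2 / 2) *
          ((1 - κ) ^ (-a - 1) * L ((1 / τ ^ 2) * (1 / κ - 1)))) (Ioo (0 : ℝ) 1) := hc1.add hc2
    rw [integral_add (hfint.const_mul _) hc3, integral_add hc1 hc2,
      integral_const_mul, integral_const_mul, setIntegral_const]
    simp only [Measure.real, Real.volume_Ioo, sub_zero, ENNReal.ofReal_one, ENNReal.toReal_one,
      one_smul]
    rw [integral_const_mul]
    gcongr
  have hr : A * Real.exp (3 / 8 * x ^ 2) +
        Real.exp ((1 - η) * x ^ 2 / 2) * ((τ ^ 2) ^ (-a) * I) ≤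
      (A + I) / c * (Real.exp (-x ^ 2 / 16) +
        Real.exp (-(η - d) * x ^ 2 / 2) * (τ ^ 2) ^ (-a)) * D := by
    have hτa : 0 ≤ (τ ^ 2) ^ (-a) := by positivity
    have e1 : Real.exp (3 / 8 * x ^ 2) ≤
        Real.exp (-x ^ 2 / 16) * Real.exp ((1 - d) * x ^ 2 / 2) := by
      rw [← Real.exp_add]
      refine Real.exp_le_exp.2 ?_
      nlinarith [mul_le_mul_of_nonneg_right hd8 (sq_nonneg x)]
    have e2 : Real.exp ((1 - η) * x ^ 2 / 2) =
        Real.exp (-(η - d) * x ^ 2 / 2) * Real.exp ((1 - d) * x ^ 2 / 2) := by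
      rw [← Real.exp_add]
      congr 1
      ring
    set E := Real.exp ((1 - d) * x ^ 2 / 2)
    set P := Real.exp (-x ^ 2 / 16)
    set Q := Real.exp (-(η - d) * x ^ 2 / 2)
    have hP : 0 < P := Real.exp_pos _
    have hQ : 0 < Q := Real.exp_pos _
    have hE : 0 < E := Real.exp_pos _
    calc _ ≤ A * (P * E) + (Q * E) * ((τ ^ 2) ^ (-a) * I) := by rw [e2]; gcongr
      _ ≤ (A + I) * (P + Q * (τ ^ 2) ^ (-a)) * E := by
          have : 0 ≤ I * (P * E) + A * (Q * (τ ^ 2) ^ (-a) * E) := by positivity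
          nlinarith
      _ = (A + I) / c * (P + Q * (τ ^ 2) ^ (-a)) * (c * E) := by field_simp
      _ ≤ _ := by gcongr
  unfold E1mK kExp
  rw [le_div_iff₀ hDpos, hnum]
  linarith

lemma E1mK_mem_Icc {a : ℝ} (ha : 1 / 2 ≤ a ∧ a < 1) {L : ℝ → ℝ}
    (hLm : Measurable L) (hL0 : ∀ t, 0 < t → 0 < L t)
    (hI : IntegrableOn (fun t => t ^ (-a - 1) * L t) (Ioi (0 : ℝ))) {τ : ℝ} (hτ : 0 < τ) (x : ℝ) :
    E1mK a L x τ ∈ Icc (0 : ℝ) 1 := by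
  have hfint := integrableOn_kdens ha hLm hL0 hI hτ x
  have hnum : ∀ᵐ κ ∂(volume.restrict (Ioo (0 : ℝ) 1)), 0 ≤ (1 - κ) * kdens a L x τ κ := by
    filter_upwards [ae_restrict_mem measurableSet_Ioo] with κ hκ
    exact mul_nonneg (sub_nonneg.2 hκ.2.le) (kdens_pos hL0 hτ hκ).le
  have hden : 0 ≤ ∫ κ in Ioo (0 : ℝ) 1, kdens a L x τ κ :=
    setIntegral_nonneg measurableSet_Ioo fun κ hκ => (kdens_pos hL0 hτ hκ).le
  refine ⟨div_nonneg (integral_nonneg_of_ae hnum) hden, div_le_one_of_le₀ ?_ hden⟩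
  refine integral_mono_of_nonneg hnum hfint ?_
  filter_upwards [ae_restrict_mem measurableSet_Ioo] with κ hκ
  exact mul_le_of_le_one_left (kdens_pos hL0 hτ hκ).le (by linarith [hκ.1])

lemma measurable_E1mK (a : ℝ) {L : ℝ → ℝ} (hLm : Measurable L) (x : ℝ) :
    Measurable (fun τ => E1mK a L x τ) := by
  have h := measurable_kdens_uncurry a hLm x
  have h2 : Measurable (Function.uncurry fun τ κ => (1 - κ) * kdens a L x τ κ) :=
    (measurable_const.sub measurable_snd).mul h
  unfold E1mK kExp
  exact (h2.stronglyMeasurable.integral_prod_right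
      (ν := volume.restrict (Ioo (0 : ℝ) 1))).measurable.div
    (h.stronglyMeasurable.integral_prod_right (ν := volume.restrict (Ioo (0 : ℝ) 1))).measurable

lemma measurable_marg (a K : ℝ) {L : ℝ → ℝ} (hLm : Measurable L) (x : ℝ) :
    Measurable (fun τ => marg a K L x τ) := by
  unfold marg
  refine (StronglyMeasurable.integral_prod_right (ν := volume.restrict (Ioi (0 : ℝ)))
    (f := fun τ l => K * l ^ (-a-1) * L l *
    ((Real.sqrt (2 * Real.pi * (1 + l * τ^2)))⁻¹ * Real.exp (-(x^2) / (2 * (1 + l * τ^2)))))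
    (Measurable.stronglyMeasurable ?_)).measurable
  unfold Function.uncurry
  fun_prop

/-- The marginal density lies in `(0, 1]`. -/
lemma marg_mem_Ioc {a K : ℝ} {L : ℝ → ℝ} (hLm : Measurable L) (hL0 : ∀ t, 0 < t → 0 < L t)
    (hK : Kcond a L K) (x τ : ℝ) : marg a K L x τ ∈ Ioc (0 : ℝ) 1 := by
  obtain ⟨hI, hpos, rfl⟩ := hK
  set I := ∫ t in Ioi (0 : ℝ), t ^ (-a - 1) * L t with hIdef
  set F : ℝ → ℝ := fun l => I⁻¹ * l ^ (-a-1) * L l *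
    ((Real.sqrt (2 * Real.pi * (1 + l * τ^2)))⁻¹ * Real.exp (-(x^2) / (2 * (1 + l * τ^2)))) with hF
  have hFpos : ∀ l ∈ Ioi (0 : ℝ), 0 < F l := by
    intro l (hl : 0 < l)
    have := hL0 l hl
    simp only [hF]
    positivity
  have hFle : ∀ l ∈ Ioi (0 : ℝ), F l ≤ I⁻¹ * (l ^ (-a - 1) * L l) := by
    intro l (hl : 0 < l)
    have := hL0 l hl
    have h1 : 1 ≤ Real.sqrt (2 * Real.pi * (1 + l * τ ^ 2)) := by
      rw [Real.one_le_sqrt]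
      have h2 : 0 ≤ l * τ ^ 2 := by positivity
      nlinarith [Real.pi_gt_three]
    have h3 : Real.exp (-(x^2) / (2 * (1 + l * τ^2))) ≤ 1 := by
      rw [Real.exp_le_one_iff]
      exact div_nonpos_of_nonpos_of_nonneg (by linarith [sq_nonneg x]) (by positivity)
    have h4 : (Real.sqrt (2 * Real.pi * (1 + l * τ ^ 2)))⁻¹ ≤ 1 := inv_le_one_of_one_le₀ h1
    simp only [hF]
    rw [← mul_assoc I⁻¹]
    exact mul_le_of_le_one_right (by positivity)
      (mul_le_one₀ h4 (Real.exp_pos _).le h3)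
  have hFint : IntegrableOn F (Ioi (0 : ℝ)) := by
    refine (hI.const_mul I⁻¹).mono' (Measurable.aestronglyMeasurable (by fun_prop)) ?_
    filter_upwards [ae_restrict_mem measurableSet_Ioi] with l hl
    rw [Real.norm_of_nonneg (hFpos l hl).le]
    exact hFle l hl
  have hmarg : marg a I⁻¹ L x τ = ∫ l in Ioi (0 : ℝ), F l := rfl
  rw [hmarg]
  constructor
  · rw [setIntegral_pos_iff_support_of_nonneg_ae _ hFint]
    · have hsub : Ioi (0 : ℝ) ⊆ Function.support F ∩ Ioi 0 :=
        fun l hl => ⟨(hFpos l hl).ne', hl⟩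
      exact lt_of_lt_of_le (by simp) (measure_mono hsub)
    · filter_upwards [ae_restrict_mem measurableSet_Ioi] with l hl
      exact (hFpos l hl).le
  · refine (setIntegral_mono_on hFint (hI.const_mul _) measurableSet_Ioi hFle).trans ?_
    rw [integral_const_mul, inv_mul_cancel₀ hpos.ne']

/-- Bounds on `E(1 - κ | x, τ)` uniform over the support of `τ` carry over to the full Bayes
shrinkage weight. -/
lemma fbShrink_mem_Icc {a K : ℝ} {L : ℝ → ℝ} (hLm : Measurable L)
    (hL0 : ∀ t, 0 < t → 0 < L t) (hK : Kcond a L K) {q : ℝ → ℝ} {lo hi : ℝ}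
    (hq0 : ∀ τ, 0 ≤ q τ) (hq1 : ∫ τ in Icc lo hi, q τ = 1) {n : ℕ} (X : Fin n → ℝ) (i : Fin n)
    {m M : ℝ} (hE : ∀ τ ∈ Icc lo hi, E1mK a L (X i) τ ∈ Icc m M) :
    fbShrink a K L q lo hi n X i ∈ Icc m M := by
  have hqint : IntegrableOn q (Icc lo hi) := by
    by_contra h
    rw [integral_undef h] at hq1
    exact zero_ne_one hq1
  set P : ℝ → ℝ := fun τ => ∏ j, marg a K L (X j) τ with hP
  have hPm : Measurable P :=
    Finset.measurable_fun_prod _ fun j _ => measurable_marg a K hLm (X j)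
  have hPpos : ∀ τ, 0 < P τ := fun τ =>
    Finset.prod_pos fun j _ => (marg_mem_Ioc hLm hL0 hK (X j) τ).1
  have hPle : ∀ τ, P τ ≤ 1 := fun τ =>
    Finset.prod_le_one (fun j _ => (marg_mem_Ioc hLm hL0 hK (X j) τ).1.le)
      fun j _ => (marg_mem_Ioc hLm hL0 hK (X j) τ).2
  have hWint : IntegrableOn (fun τ => q τ * P τ) (Icc lo hi) := by
    refine hqint.mono' (hqint.aestronglyMeasurable.mul hPm.aestronglyMeasurable)
      (ae_of_all _ fun τ => ?_)
    rw [Real.norm_of_nonneg (mul_nonneg (hq0 τ) (hPpos τ).le)]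
    exact mul_le_of_le_one_right (hq0 τ) (hPle τ)
  set Z := ∫ s in Icc lo hi, q s * P s with hZ
  have hZpos : 0 < Z := by
    rw [hZ, setIntegral_pos_iff_support_of_nonneg_ae
      (ae_of_all _ fun τ => mul_nonneg (hq0 τ) (hPpos τ).le) hWint]
    have h1 : 0 < ∫ τ in Icc lo hi, q τ := by rw [hq1]; exact one_pos
    rw [setIntegral_pos_iff_support_of_nonneg_ae (ae_of_all _ hq0) hqint] at h1
    refine h1.trans_le (measure_mono ?_)
    rintro τ ⟨h2, h3⟩
    exact ⟨mul_ne_zero h2 (hPpos τ).ne', h3⟩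
  have hw : ∀ τ, tauWeight a K L q lo hi n X τ = (q τ * P τ) / Z := fun τ => rfl
  have hwint : IntegrableOn (fun τ => tauWeight a K L q lo hi n X τ) (Icc lo hi) :=
    hWint.div_const Z
  have hw0 : ∀ τ, 0 ≤ tauWeight a K L q lo hi n X τ := fun τ => by
    rw [hw]
    exact div_nonneg (mul_nonneg (hq0 τ) (hPpos τ).le) hZpos.le
  have hw1 : ∫ τ in Icc lo hi, tauWeight a K L q lo hi n X τ = 1 := by
    simp only [hw]
    rw [integral_div, ← hZ, div_self hZpos.ne']
  have hEw : IntegrableOn (fun τ => E1mK a L (X i) τ * tauWeight a K L q lo hi n X τ)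
      (Icc lo hi) := by
    refine (hwint.const_mul (max |m| |M|)).mono'
      ((measurable_E1mK a hLm (X i)).aestronglyMeasurable.mul hwint.aestronglyMeasurable) ?_
    filter_upwards [ae_restrict_mem measurableSet_Icc] with τ hτ
    rw [norm_mul, Real.norm_of_nonneg (hw0 τ), Real.norm_eq_abs]
    exact mul_le_mul_of_nonneg_right (abs_le_max_abs_abs (hE τ hτ).1 (hE τ hτ).2) (hw0 τ)
  unfold fbShrink
  constructor
  · calc m = ∫ τ in Icc lo hi, m * tauWeight a K L q lo hi n X τ := by
          rw [integral_const_mul, hw1, mul_one]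
      _ ≤ _ := setIntegral_mono_on (hwint.const_mul m) hEw measurableSet_Icc fun τ hτ =>
          mul_le_mul_of_nonneg_right (hE τ hτ).1 (hw0 τ)
  · calc _ ≤ ∫ τ in Icc lo hi, M * tauWeight a K L q lo hi n X τ :=
          setIntegral_mono_on hEw (hwint.const_mul M) measurableSet_Icc fun τ hτ =>
          mul_le_mul_of_nonneg_right (hE τ hτ).2 (hw0 τ)
      _ = M := by rw [integral_const_mul, hw1, mul_one]

lemma gaussianPDFReal_zero_one (x : ℝ) :
    gaussianPDFReal 0 1 x = (Real.sqrt (2 * Real.pi))⁻¹ * Real.exp (-x ^ 2 / 2) := by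
  simp [gaussianPDFReal]

lemma gaussianReal_preimage_neg (s : Set ℝ) (hs : MeasurableSet s) :
    gaussianReal 0 1 ((fun x => -x) ⁻¹' s) = gaussianReal 0 1 s := by
  have h := gaussianReal_map_neg (μ := 0) (v := 1)
  rw [neg_zero] at h
  rw [← Measure.map_apply measurable_neg hs]
  exact congrArg (fun ν : Measure ℝ => ν s) h

lemma gaussianReal_toReal_Ioi_le {z : ℝ} (hz : 0 < z) :
    (gaussianReal 0 1 (Ioi z)).toReal ≤ Real.exp (-z ^ 2 / 2) / (2 * z) := by
  rw [gaussianReal_apply_eq_integral 0 one_ne_zero, ENNReal.toReal_ofReal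
    (integral_nonneg fun x => gaussianPDFReal_nonneg 0 1 x)]
  have hder : ∀ x ∈ Ici z, HasDerivAt (fun x : ℝ => -(1 / (2 * z)) * Real.exp (-x ^ 2 / 2))
      (1 / (2 * z) * (x * Real.exp (-x ^ 2 / 2))) x := by
    intro x _
    have h1 : HasDerivAt (fun x : ℝ => -x ^ 2 / 2) (-x) x :=
      (((hasDerivAt_pow 2 x).fun_neg).div_const 2).congr_deriv (by simp; ring)
    exact ((h1.exp).const_mul (-(1 / (2 * z)))).congr_deriv (by ring)
  have hlim : Tendsto (fun x : ℝ => -(1 / (2 * z)) * Real.exp (-x ^ 2 / 2)) atTop (nhds 0) := by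
    have h1 : Tendsto (fun x : ℝ => -x ^ 2 / 2) atTop atBot := by
      have h2 : Tendsto (fun x : ℝ => x ^ 2) atTop atTop := tendsto_pow_atTop two_ne_zero
      exact (tendsto_neg_atTop_atBot.comp h2).atBot_div_const two_pos
    simpa using (Real.tendsto_exp_atBot.comp h1).const_mul (-(1 / (2 * z)))
  have hnn : ∀ x ∈ Ioi z, 0 ≤ 1 / (2 * z) * (x * Real.exp (-x ^ 2 / 2)) := fun x hx => by
    have : 0 < x := hz.trans hx
    positivity
  have hfint := integrableOn_Ioi_deriv_of_nonneg' hder hnn hlim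
  have hval := integral_Ioi_of_hasDerivAt_of_nonneg' hder hnn hlim
  calc ∫ x in Ioi z, gaussianPDFReal 0 1 x
      ≤ ∫ x in Ioi z, 1 / (2 * z) * (x * Real.exp (-x ^ 2 / 2)) := by
        refine setIntegral_mono_on (integrable_gaussianPDFReal 0 1).integrableOn hfint
          measurableSet_Ioi fun x hx => ?_
        have hx' : z < x := hx
        rw [gaussianPDFReal_zero_one, ← mul_assoc]
        refine mul_le_mul_of_nonneg_right ?_ (Real.exp_pos _).le
        have h2 : (2 : ℝ) ≤ Real.sqrt (2 * Real.pi) := by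
          apply Real.le_sqrt_of_sq_le
          nlinarith [Real.pi_gt_three]
        calc (Real.sqrt (2 * Real.pi))⁻¹ ≤ 2⁻¹ := inv_anti₀ two_pos h2
          _ = 1 / (2 * z) * z := by field_simp
          _ ≤ _ := by gcongr
    _ = _ := by rw [hval]; ring

/-- Mills-type bound for the two-sided standard normal tail. -/
lemma gaussianReal_toReal_lt_abs_le {z : ℝ} (hz : 0 < z) :
    (gaussianReal 0 1 {x | z < |x|}).toReal ≤ Real.exp (-z ^ 2 / 2) / z := by
  have hset : {x : ℝ | z < |x|} = Ioi z ∪ (fun x => -x) ⁻¹' Ioi z := by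
    ext x
    simp [lt_abs, lt_neg]
  have h1 := gaussianReal_toReal_Ioi_le hz
  have h2 : (gaussianReal 0 1 {x | z < |x|}).toReal ≤
      (gaussianReal 0 1 (Ioi z)).toReal + (gaussianReal 0 1 (Ioi z)).toReal := by
    rw [hset]
    refine (measureReal_union_le (μ := gaussianReal 0 1) _ _).trans (le_of_eq ?_)
    simp only [Measure.real]
    rw [gaussianReal_preimage_neg _ measurableSet_Ioi]
  calc _ ≤ Real.exp (-z ^ 2 / 2) / (2 * z) + Real.exp (-z ^ 2 / 2) / (2 * z) := by linarith
    _ = _ := by field_simp; ring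

lemma Phi_eq_integral (z : ℝ) : Phi z = ∫ x in Iic z, gaussianPDFReal 0 1 x := by
  rw [Phi, gaussianReal_apply_eq_integral 0 one_ne_zero, ENNReal.toReal_ofReal
    (integral_nonneg fun x => gaussianPDFReal_nonneg 0 1 x)]

lemma continuous_Phi : Continuous Phi := by
  have hi := integrable_gaussianPDFReal 0 1
  have h : Phi = fun z => Phi 0 + ∫ x in (0 : ℝ)..z, gaussianPDFReal 0 1 x := by
    ext z
    rw [Phi_eq_integral, Phi_eq_integral,
      ← intervalIntegral.integral_Iic_sub_Iic hi.integrableOn hi.integrableOn]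
    ring
  rw [h]
  exact continuous_const.add
    (intervalIntegral.continuous_primitive (fun _ _ => hi.intervalIntegrable) 0)

lemma gaussianReal_toReal_Icc_neg {r : ℝ} (hr : 0 ≤ r) :
    (gaussianReal 0 1 (Icc (-r) r)).toReal = 2 * Phi r - 1 := by
  have := nullSingletonClass_gaussianReal (μ := 0) (v := 1) one_ne_zero
  have h1 : (gaussianReal 0 1).real (Iic r) =
      (gaussianReal 0 1).real (Icc (-r) r) + (gaussianReal 0 1).real (Iio (-r)) := by
    rw [← measureReal_union _ measurableSet_Iio]
    · congr 1
      ext x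
      simp only [mem_Iic, mem_union, mem_Icc, mem_Iio]
      constructor
      · intro h
        rcases lt_or_ge x (-r) with h' | h'
        · exact Or.inr h'
        · exact Or.inl ⟨h', h⟩
      · rintro (h | h) <;> linarith
    · refine Set.disjoint_left.2 fun x hx hx' => ?_
      exact absurd hx' (not_lt.2 hx.1)
  have h2 : (gaussianReal 0 1).real (Iio (-r)) = (gaussianReal 0 1).real (Ioi r) := by
    simp only [Measure.real]
    rw [← gaussianReal_preimage_neg _ measurableSet_Ioi]
    congr 2
    ext x
    simp
  have h3 : (gaussianReal 0 1).real (Ioi r) = 1 - (gaussianReal 0 1).real (Iic r) := by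
    rw [← compl_Iic, probReal_compl_eq_one_sub measurableSet_Iic]
  have h4 : Phi r = (gaussianReal 0 1).real (Iic r) := rfl
  change (gaussianReal 0 1).real (Icc (-r) r) = _
  rw [h4]
  linarith

lemma two_mul_Phi_sub_one_pos {r : ℝ} (hr : 0 < r) : 0 < 2 * Phi r - 1 := by
  rw [← gaussianReal_toReal_Icc_neg hr.le]
  refine ENNReal.toReal_pos ?_ (measure_ne_top _ _)
  intro h
  have h2 := gaussianReal_absolutelyContinuous' 0 (v := 1) one_ne_zero h
  rw [Real.volume_Icc, ENNReal.ofReal_eq_zero] at h2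
  linarith

lemma gaussianReal_toReal_sq_le {v T : ℝ} (hv : 0 < v) (hT : 0 ≤ T) :
    (gaussianReal 0 (Real.toNNReal v) {x | x ^ 2 ≤ T}).toReal =
      2 * Phi (Real.sqrt (T / v)) - 1 := by
  rw [← gaussianReal_toReal_Icc_neg (Real.sqrt_nonneg _)]
  have h := gaussianReal_map_const_mul (μ := 0) (v := 1) (Real.sqrt v)
  have hm : MeasurableSet {x : ℝ | x ^ 2 ≤ T} :=
    measurableSet_le (measurable_id.pow_const 2) measurable_const
  have hv' : Real.toNNReal v = NNReal.mk (Real.sqrt v ^ 2) (sq_nonneg _) * 1 := by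
    ext
    simp [Real.sq_sqrt hv.le, hv.le]
  rw [mul_zero, ← hv'] at h
  rw [← h, Measure.map_apply (measurable_const_mul _) hm]
  congr 2
  ext x
  simp only [mem_preimage, mem_ofPred_eq, mem_Icc, ← abs_le]
  rw [mul_pow, Real.sq_sqrt hv.le, Real.le_sqrt (abs_nonneg _) (by positivity), sq_abs,
    le_div_iff₀ hv, mul_comm]

lemma isProbabilityMeasure_mixM {p : ℝ} (hp : 0 ≤ p ∧ p ≤ 1) (u : ℝ) :
    IsProbabilityMeasure (mixM p u) := by
  constructor
  simp only [mixM, Measure.add_apply, Measure.smul_apply, measure_univ, smul_eq_mul, mul_one]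
  rw [← ENNReal.ofReal_add (by linarith) hp.1]
  simp

lemma pi_preimage_eval_le {n : ℕ} (μ : Fin n → Measure ℝ) [∀ j, IsProbabilityMeasure (μ j)]
    (i : Fin n) {S : Set (Fin n → ℝ)} {B : Set ℝ} (hB : MeasurableSet B)
    (hS : ∀ x ∈ S, x i ∈ B) : (Measure.pi μ S).toReal ≤ (μ i B).toReal := by
  refine ENNReal.toReal_mono (measure_ne_top _ _) ?_
  rw [← (measurePreserving_eval μ i).measure_preimage hB.nullMeasurableSet]
  exact measure_mono hS

lemma nullMeas_toReal_le {n : ℕ} (i : Fin n) {p : ℝ} (hp : 0 ≤ p ∧ p ≤ 1) (u : ℝ)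
    {S : Set (Fin n → ℝ)} {B : Set ℝ} (hB : MeasurableSet B) (hS : ∀ x ∈ S, x i ∈ B) :
    (nullMeas n i p u S).toReal ≤ (gaussianReal 0 1 B).toReal := by
  have := isProbabilityMeasure_mixM hp u
  have (j : Fin n) : IsProbabilityMeasure (if j = i then gaussianReal 0 1 else mixM p u) := by
    split_ifs <;> infer_instance
  have h := pi_preimage_eval_le
    (fun j : Fin n => if j = i then gaussianReal 0 1 else mixM p u) i hB hS
  rwa [if_pos rfl] at h

lemma altMeas_toReal_le {n : ℕ} (i : Fin n) {p : ℝ} (hp : 0 ≤ p ∧ p ≤ 1) (u : ℝ)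
    {S : Set (Fin n → ℝ)} {B : Set ℝ} (hB : MeasurableSet B) (hS : ∀ x ∈ S, x i ∈ B) :
    (altMeas n i p u S).toReal ≤ (gaussianReal 0 (Real.toNNReal (1 + u)) B).toReal := by
  have := isProbabilityMeasure_mixM hp u
  have (j : Fin n) : IsProbabilityMeasure
      (if j = i then gaussianReal 0 (Real.toNNReal (1 + u)) else mixM p u) := by
    split_ifs <;> infer_instance
  have h := pi_preimage_eval_le
    (fun j : Fin n => if j = i then gaussianReal 0 (Real.toNNReal (1 + u)) else mixM p u) i hB hS
  rwa [if_pos rfl] at h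

lemma tendsto_log_natCast : Tendsto (fun n : ℕ => Real.log n) atTop atTop :=
  Real.tendsto_log_atTop.comp tendsto_natCast_atTop_atTop

lemma CondC3.eventually_small {π2 : ℕ → ℝ → ℝ} {α : ℕ → ℝ} (hC3 : CondC3 π2 α) (t0 : ℝ) :
    ∀ᶠ n : ℕ in atTop, 0 < α n ∧ α n ≤ 1 ∧ 1 ≤ n ∧
      ∀ τ ∈ Icc ((n : ℝ)⁻¹) (α n), 0 < τ ∧ t0 * τ ^ 2 ≤ 1 / 4 := by
  obtain ⟨-, -, -, hα0, hnα⟩ := hC3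
  have h1 : Tendsto (fun n => |t0| * α n ^ 2) atTop (nhds 0) := by
    simpa using (hα0.pow 2).const_mul |t0|
  filter_upwards [hnα.eventually_gt_atTop 0, hα0.eventually_le_const one_pos,
    eventually_ge_atTop 1, h1.eventually_le_const (show (0 : ℝ) < 1 / 4 by norm_num)]
    with n h2 h3 h4 h5
  have hn : (0 : ℝ) < n := by exact_mod_cast h4
  refine ⟨pos_of_mul_pos_right h2 hn.le, h3, h4, fun τ hτ => ?_⟩
  have hτ0 : 0 < τ := (inv_pos.2 hn).trans_le hτ.1
  refine ⟨hτ0, le_trans ?_ h5⟩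
  have := hτ.2
  have := le_abs_self t0
  gcongr

/-- The type I error of the full Bayes rule is `o(1/n)`, uniformly over the coordinates. -/
lemma exists_t1FB_le {a : ℝ} (ha : 1 / 2 ≤ a ∧ a < 1) {L : ℝ → ℝ} {Mb c0 t0 K : ℝ}
    (hL : AssumpL L Mb c0 t0) (hK : Kcond a L K) {π2 : ℕ → ℝ → ℝ} {α : ℕ → ℝ}
    (hC3 : CondC3 π2 α) {p : ℕ → ℝ} (u : ℕ → ℝ) (hp : ∀ n, 0 ≤ p n ∧ p n ≤ 1)
    {cs : ℕ → ℝ} (hcs : Tendsto cs atTop atTop)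
    (hα : ∀ᶠ n : ℕ in atTop,
      Real.log (1 / α n) = Real.log n - (1 / 2) * Real.log (Real.log n) + cs n) :
    ∃ b : ℕ → ℝ, Tendsto (fun n : ℕ => (n : ℝ) * b n) atTop (nhds 0) ∧
      ∀ᶠ n : ℕ in atTop, 0 ≤ b n ∧ ∀ i : Fin n, t1FB a K L π2 α p u n i ≤ b n := by
  have hL' := hL
  obtain ⟨hLm, hL0, -⟩ := hL
  obtain ⟨A, hA, hE⟩ := exists_E1mK_le ha hL' hK.1
  have hlog := tendsto_log_natCast
  have hsmall := hC3.eventually_small t0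
  refine ⟨fun n => 2 * A * α n / Real.sqrt (Real.log n), ?_, ?_⟩
  · have hlim : Tendsto (fun n => 2 * A * Real.exp (-cs n)) atTop (nhds 0) := by
      simpa using (Real.tendsto_exp_neg_atTop_nhds_zero.comp hcs).const_mul (2 * A)
    refine hlim.congr' ?_
    filter_upwards [hα, hsmall, hlog.eventually_gt_atTop 0] with n h1 ⟨h2, h3, h4, _⟩ h5
    have hn : (0 : ℝ) < n := by exact_mod_cast h4
    have hα' : α n = (n : ℝ)⁻¹ * Real.sqrt (Real.log n) * Real.exp (-cs n) := by
      rw [one_div, Real.log_inv] at h1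
      have h6 : Real.sqrt (Real.log n) = Real.exp (1 / 2 * Real.log (Real.log n)) := by
        rw [Real.sqrt_eq_rpow, Real.rpow_def_of_pos h5, mul_comm]
      calc α n = Real.exp (Real.log (α n)) := (Real.exp_log h2).symm
        _ = Real.exp (-Real.log n + 1 / 2 * Real.log (Real.log n) + -cs n) := by
            congr 1; linarith
        _ = _ := by rw [Real.exp_add, Real.exp_add, Real.exp_neg, Real.exp_log hn, h6]
    have h7 : 0 < Real.sqrt (Real.log n) := Real.sqrt_pos.2 h5
    rw [hα']
    field_simp
  · have hll : ∀ᶠ n : ℕ in atTop, Real.log (Real.log n) ≤ 1 / 2 * Real.log n := by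
      filter_upwards [hlog.eventually (Real.isLittleO_log_id_atTop.bound
        (show (0 : ℝ) < 1 / 2 by norm_num)), hlog.eventually_gt_atTop 0] with n h1 h2
      simp only [id, Real.norm_eq_abs, abs_of_pos h2] at h1
      exact (le_abs_self _).trans h1
    filter_upwards [hα, hsmall, hlog.eventually_gt_atTop 0, hll, hcs.eventually_ge_atTop 0,
      hlog.eventually_ge_atTop (4 * Real.log (2 * A))] with n h1 ⟨h2, h3, h4, hτ⟩ h5 h6 h7 h8
    refine ⟨by positivity, fun i => ?_⟩
    set l := Real.log n with hl
    set ℓ := Real.log (1 / α n) with hℓ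
    have hαexp : α n = Real.exp (-ℓ) := by
      rw [hℓ, one_div, Real.log_inv, neg_neg, Real.exp_log h2]
    have hℓl : 3 / 4 * l ≤ ℓ := by linarith
    set z2 := 4 * a * ℓ - 2 * Real.log (2 * A) with hz2
    have hz2l : l ≤ z2 := by nlinarith
    have hαpow : α n ^ (2 * a) = Real.exp (-(2 * a * ℓ)) := by
      rw [hαexp, ← Real.exp_mul]
      congr 1
      ring
    have hz2exp : Real.exp (z2 / 2) * (2 * A * α n ^ (2 * a)) = 1 := by
      rw [hαpow, ← Real.exp_log (show 0 < 2 * A by positivity), ← Real.exp_add, ← Real.exp_add,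
        Real.exp_eq_one_iff]
      rw [hz2]
      ring
    have hsub : ∀ x ∈ {x : Fin n → ℝ | 1 / 2 < fbShrink a K L (π2 n) ((n : ℝ)⁻¹) (α n) n x i},
        x i ∈ {y : ℝ | Real.sqrt z2 < |y|} := by
      intro x hx
      by_contra hcon
      have hcon' : x i ^ 2 ≤ z2 := by
        have h9 : |x i| ≤ Real.sqrt z2 := not_lt.1 hcon
        rw [Real.le_sqrt (abs_nonneg _) (h5.le.trans hz2l), sq_abs] at h9
        exact h9
      have hmem := fbShrink_mem_Icc hLm hL0 hK (hC3.1 n) (hC3.2.2.1 n h4) x i (m := 0)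
        (M := 1 / 2) fun τ hτm => by
          obtain ⟨hτ0, hτ4⟩ := hτ τ hτm
          refine ⟨(E1mK_mem_Icc ha hLm hL0 hK.1 hτ0 _).1, (hE τ (x i) hτ0 hτ4).trans ?_⟩
          calc A * Real.exp (x i ^ 2 / 2) * τ ^ (2 * a)
              ≤ A * Real.exp (z2 / 2) * α n ^ (2 * a) := by
                have h10 : τ ^ (2 * a) ≤ α n ^ (2 * a) :=
                  Real.rpow_le_rpow hτ0.le hτm.2 (by linarith)
                gcongr
            _ = 1 / 2 := by linarith
      exact absurd hx (not_lt.2 hmem.2)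
    have hz2pos : 0 < z2 := h5.trans_le hz2l
    have hmeas : MeasurableSet {y : ℝ | Real.sqrt z2 < |y|} :=
      measurableSet_lt measurable_const measurable_id.abs
    calc t1FB a K L π2 α p u n i
        ≤ (gaussianReal 0 1 {y : ℝ | Real.sqrt z2 < |y|}).toReal :=
          nullMeas_toReal_le i (hp n) (u n) hmeas hsub
      _ ≤ Real.exp (-Real.sqrt z2 ^ 2 / 2) / Real.sqrt z2 :=
          gaussianReal_toReal_lt_abs_le (Real.sqrt_pos.2 hz2pos)
      _ = 2 * A * α n ^ (2 * a) / Real.sqrt z2 := by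
          rw [Real.sq_sqrt hz2pos.le, neg_div, Real.exp_neg, inv_eq_of_mul_eq_one_right hz2exp]
      _ ≤ 2 * A * α n / Real.sqrt l := by
          have h11 : α n ^ (2 * a) ≤ α n := by
            simpa using Real.rpow_le_rpow_of_exponent_ge h2 h3 (show 1 ≤ 2 * a by linarith)
          have h12 : 0 < Real.sqrt l := Real.sqrt_pos.2 h5
          gcongr

/-- Assumption 2 together with `p_n ∝ n^(-e)` fixes the growth of `log n` relative to `u_n`. -/
lemma tendsto_log_div {p u : ℕ → ℝ} {C e : ℝ} (hA2 : Assump2 p u C) (he : 0 < e)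
    (hpe : propToR p (-e)) :
    Tendsto (fun n : ℕ => Real.log n / u n) atTop (nhds (C / (2 * e))) := by
  obtain ⟨hp0, hu, -, hC⟩ := hA2
  obtain ⟨k1, k2, hk1, hk2, hk⟩ := hpe
  have huinv : Tendsto (fun n => (u n)⁻¹) atTop (nhds 0) := tendsto_inv_atTop_zero.comp hu
  have h1 : Tendsto (fun n => Real.log (u n) / u n) atTop (nhds 0) :=
    (Real.isLittleO_log_id_atTop.tendsto_div_nhds_zero).comp hu
  have h2 : Tendsto (fun n => Real.log (1 - p n) / u n) atTop (nhds 0) := by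
    have h3 : Tendsto (fun n => Real.log (1 - p n)) atTop (nhds 0) := by
      have h4 : Tendsto (fun n => 1 - p n) atTop (nhds 1) := by simpa using hp0.const_sub 1
      simpa using h4.log one_ne_zero
    simpa [div_eq_mul_inv] using h3.mul huinv
  have h5 : Tendsto (fun n : ℕ => (Real.log (p n) + e * Real.log n) / u n) atTop (nhds 0) := by
    have hlo : Tendsto (fun n => Real.log k1 * (u n)⁻¹) atTop (nhds 0) := by
      simpa using huinv.const_mul (Real.log k1)
    have hhi : Tendsto (fun n => Real.log k2 * (u n)⁻¹) atTop (nhds 0) := by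
      simpa using huinv.const_mul (Real.log k2)
    have key : ∀ᶠ n : ℕ in atTop, Real.log k1 ≤ Real.log (p n) + e * Real.log n ∧
        Real.log (p n) + e * Real.log n ≤ Real.log k2 := by
      filter_upwards [hk, eventually_ge_atTop 1] with n ⟨h6, h7⟩ hn
      have hn' : (0 : ℝ) < n := by exact_mod_cast hn
      have h8 : 0 < (n : ℝ) ^ (-e) := Real.rpow_pos_of_pos hn' _
      have h9 : ∀ k : ℝ, 0 < k → Real.log (k * (n : ℝ) ^ (-e)) = Real.log k - e * Real.log n := by
        intro k hk
        rw [Real.log_mul hk.ne' h8.ne', Real.log_rpow hn']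
        ring
      have h10 := Real.log_le_log (by positivity) h6
      have h11 := Real.log_le_log (lt_of_lt_of_le (by positivity) h6) h7
      rw [h9 _ hk1] at h10
      rw [h9 _ hk2] at h11
      constructor <;> linarith
    refine tendsto_of_tendsto_of_tendsto_of_le_of_le' hlo hhi ?_ ?_
    · filter_upwards [key, hu.eventually_gt_atTop 0] with n h6 h7
      rw [div_eq_mul_inv]
      exact mul_le_mul_of_nonneg_right h6.1 (inv_pos.2 h7).le
    · filter_upwards [key, hu.eventually_gt_atTop 0] with n h6 h7
      rw [div_eq_mul_inv]
      exact mul_le_mul_of_nonneg_right h6.2 (inv_pos.2 h7).le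
  have h12 := (((hC.sub h1).sub (h2.const_mul 2)).add (h5.const_mul 2)).div_const (2 * e)
  have h13 : (C - 0 - 2 * 0 + 2 * 0) / (2 * e) = C / (2 * e) := by ring
  rw [h13] at h12
  refine h12.congr' ?_
  filter_upwards [hk, eventually_ge_atTop 1, hu.eventually_gt_atTop 0,
    hp0.eventually_lt_const one_pos] with n h6 hn h7 h8
  have hn' : (0 : ℝ) < n := by exact_mod_cast hn
  have hp : 0 < p n := lt_of_lt_of_le (by positivity) h6.1
  have hp1 : 0 < 1 - p n := sub_pos.2 h8
  rw [Real.log_mul h7.ne' (by positivity), Real.log_pow, Real.log_div hp1.ne' hp.ne']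
  field_simp
  push_cast
  ring

/-- The type II error of the full Bayes rule is asymptotically at most
`2Φ(√(aρC/e)) - 1`, uniformly over the coordinates. -/
lemma exists_t2FB_le {a : ℝ} (ha : 1 / 2 ≤ a ∧ a < 1) {L : ℝ → ℝ} {Mb c0 t0 K : ℝ}
    (hL : AssumpL L Mb c0 t0) (hK : Kcond a L K) {π2 : ℕ → ℝ → ℝ} {α : ℕ → ℝ}
    (hC3 : CondC3 π2 α) {p u : ℕ → ℝ} (hp : ∀ n, 0 ≤ p n ∧ p n ≤ 1)
    {C e : ℝ} (hA2 : Assump2 p u C) (he : 0 < e) (hpe : propToR p (-e))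
    {η δ ρ : ℝ} (hη : η ∈ Ioo (0 : ℝ) 1) (hδ : δ ∈ Ioo (0 : ℝ) 1)
    (hρ : 2 / (η * (1 - δ)) < ρ) :
    ∃ b : ℕ → ℝ, Tendsto b atTop (nhds (2 * Phi (Real.sqrt (a * ρ * C / e)) - 1)) ∧
      ∀ᶠ n : ℕ in atTop, ∀ i : Fin n, t2FB a K L π2 α p u n i ≤ b n := by
  have hL' := hL
  obtain ⟨hLm, hL0, -⟩ := hL
  have hlog := tendsto_log_natCast
  have hη0 : 0 < η := hη.1
  have hδ0 : 0 < δ := hδ.1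
  have hδ1 : 0 < 1 - δ := sub_pos.2 hδ.2
  have hηδ : 0 < η * (1 - δ) := mul_pos hη0 hδ1
  have hρ0 : 0 < ρ := lt_trans (by positivity) hρ
  have ha0 : 0 < a := by linarith
  have hγ : 0 < a * (η * (1 - δ) * ρ - 2) := by
    rw [div_lt_iff₀ hηδ] at hρ
    exact mul_pos ha0 (by linarith)
  set γ := a * (η * (1 - δ) * ρ - 2) with hγdef
  set d := min (η * δ) (1 / 8) with hd
  have hd0 : 0 < d := lt_min (by positivity) (by norm_num)
  have hd1 : d ≤ η * δ := min_le_left _ _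
  obtain ⟨B, hB, hE⟩ := exists_E1mK_ge ha hL' hK.1 hη.2 hd0 (min_le_right _ _)
  refine ⟨fun n => 2 * Phi (Real.sqrt (2 * a * ρ * Real.log n / (1 + u n))) - 1, ?_, ?_⟩
  · have h1 := tendsto_log_div hA2 he hpe
    have h2 : Tendsto (fun n => 1 + (u n)⁻¹) atTop (nhds 1) := by
      simpa using (tendsto_inv_atTop_zero.comp hA2.2.1).const_add 1
    have h3 : Tendsto (fun n : ℕ => 2 * a * ρ * Real.log n / (1 + u n)) atTop
        (nhds (a * ρ * C / e)) := by
      have h4 := (h1.const_mul (2 * a * ρ)).div h2 one_ne_zero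
      have h5 : 2 * a * ρ * (C / (2 * e)) / 1 = a * ρ * C / e := by field_simp
      rw [h5] at h4
      refine h4.congr' ?_
      filter_upwards [hA2.2.1.eventually_gt_atTop 0] with n h6
      simp only [Pi.div_apply]
      field_simp
      ring
    exact (((continuous_Phi.comp Real.continuous_sqrt).tendsto _).comp h3).const_mul 2
      |>.sub_const 1
  · have hlim : Tendsto (fun n : ℕ => B * (Real.exp (-(a * ρ / 8 * Real.log n)) +
        Real.exp (-(γ * Real.log n)))) atTop (nhds 0) := by
      have h1 : ∀ c : ℝ, 0 < c → Tendsto (fun n : ℕ => Real.exp (-(c * Real.log n))) atTop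
          (nhds 0) := fun c hc =>
        Real.tendsto_exp_neg_atTop_nhds_zero.comp (hlog.const_mul_atTop hc)
      simpa using ((h1 (a * ρ / 8) (by positivity)).add (h1 γ hγ)).const_mul B
    filter_upwards [hC3.eventually_small t0, hlim.eventually_le_const
      (show (0 : ℝ) < 1 / 8 by norm_num), hlog.eventually_gt_atTop 0,
      hA2.2.1.eventually_gt_atTop 0] with n ⟨_, _, h4, hτ⟩ h5 h6 h7 i
    set l := Real.log n with hl
    have hn : (0 : ℝ) < n := by exact_mod_cast h4
    have hsub : ∀ x ∈ {x : Fin n → ℝ | fbShrink a K L (π2 n) ((n : ℝ)⁻¹) (α n) n x i ≤ 1 / 2},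
        x i ∈ {y : ℝ | y ^ 2 ≤ 2 * a * ρ * l} := by
      intro x hx
      by_contra hcon
      have hcon' : 2 * a * ρ * l ≤ x i ^ 2 := (not_le.1 hcon).le
      have hmem := fbShrink_mem_Icc hLm hL0 hK (hC3.1 n) (hC3.2.2.1 n h4) x i (m := 5 / 8)
        (M := 1) fun τ hτm => by
          obtain ⟨hτ0, hτ4⟩ := hτ τ hτm
          refine ⟨le_trans ?_ (hE τ (x i) hτ0 hτ4), (E1mK_mem_Icc ha hLm hL0 hK.1 hτ0 _).2⟩
          have e1 : Real.exp (-x i ^ 2 / 16) ≤ Real.exp (-(a * ρ / 8 * l)) :=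
            Real.exp_le_exp.2 (by linarith)
          have e2 : (τ ^ 2) ^ (-a) ≤ Real.exp (2 * a * l) := by
            calc (τ ^ 2) ^ (-a) ≤ (((n : ℝ)⁻¹) ^ 2) ^ (-a) := by
                  refine Real.rpow_le_rpow_of_nonpos (by positivity) ?_ (by linarith)
                  exact pow_le_pow_left₀ (by positivity) hτm.1 2
              _ = _ := by
                  rw [Real.rpow_def_of_pos (by positivity), Real.log_pow, Real.log_inv, ← hl]
                  congr 1
                  push_cast
                  ring
          have e3 : Real.exp (-(η - d) * x i ^ 2 / 2) ≤ Real.exp (-(η * (1 - δ) * a * ρ * l)) := by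
            refine Real.exp_le_exp.2 ?_
            have e4 : η * (1 - δ) ≤ η - d := by linarith
            have e5 : η * (1 - δ) * (2 * a * ρ * l) ≤ (η - d) * x i ^ 2 :=
              mul_le_mul e4 hcon' (by positivity) (hηδ.le.trans e4)
            linarith
          have e6 : Real.exp (-(η * (1 - δ) * a * ρ * l)) * Real.exp (2 * a * l) =
              Real.exp (-(γ * l)) := by
            rw [← Real.exp_add, hγdef]
            congr 1
            ring
          have e7 : B * (Real.exp (-x i ^ 2 / 16) +
              Real.exp (-(η - d) * x i ^ 2 / 2) * (τ ^ 2) ^ (-a)) ≤ 1 / 8 := by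
            refine le_trans ?_ h5
            rw [← e6]
            gcongr
          linarith
      have h8 : fbShrink a K L (π2 n) ((n : ℝ)⁻¹) (α n) n x i ≤ 1 / 2 := hx
      linarith [hmem.1]
    have hmeas : MeasurableSet {y : ℝ | y ^ 2 ≤ 2 * a * ρ * l} :=
      measurableSet_le (measurable_id.pow_const 2) measurable_const
    exact (altMeas_toReal_le i (hp n) (u n) hmeas hsub).trans
      (gaussianReal_toReal_sq_le (by linarith) (by positivity)).le

end PaperGL

open PaperGL MeasureTheory ProbabilityTheory Real Filter Set in
/-- Theorem 8, first part: bound on the Bayes risk of the full Bayes rule. -/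
theorem stmt12 (a : ℝ) (ha : 1/2 ≤ a ∧ a < 1) (L : ℝ → ℝ) (Mb c0 t0 K : ℝ)
    (hL : AssumpL L Mb c0 t0) (hK : Kcond a L K)
    (π2 : ℕ → ℝ → ℝ) (α : ℕ → ℝ) (hC3 : CondC3 π2 α)
    (p u : ℕ → ℝ) (hp : ∀ n, 0 ≤ p n ∧ p n ≤ 1) (hu : ∀ n, 0 < u n)
    (C e : ℝ) (hA2 : Assump2 p u C) (he : 0 < e ∧ e ≤ 1) (hpe : propToR p (-e))
    (cs : ℕ → ℝ) (hcs : Tendsto cs atTop atTop)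
    (hcso : Tendsto (fun n : ℕ => cs n / Real.log (Real.log n)) atTop (nhds 0))
    (hα : ∀ᶠ n : ℕ in atTop,
      Real.log (1/(α n)) = Real.log n - (1/2) * Real.log (Real.log n) + cs n)
    (η δ ρ : ℝ) (hη : η ∈ Set.Ioo (0:ℝ) 1) (hδ : δ ∈ Set.Ioo (0:ℝ) 1)
    (hρ : 2/(η*(1-δ)) < ρ) :
    ∃ ε : ℕ → ℝ, Tendsto ε atTop (nhds 0) ∧
      ∀ᶠ n : ℕ in atTop,
        RFB a K L π2 α p u n ≤
          (n:ℝ) * p n * (2 * Phi (Real.sqrt (a*ρ*C/e)) - 1) * (1 + ε n) := by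

  obtain ⟨b1, hb1, hb1'⟩ := exists_t1FB_le ha hL hK hC3 u hp hcs hα
  obtain ⟨b2, hb2, hb2'⟩ := exists_t2FB_le ha hL hK hC3 hp hA2 he.1 hpe hη hδ hρ
  have hρ0 : 0 < ρ := lt_of_le_of_lt
    (div_nonneg zero_le_two (mul_nonneg hη.1.le (sub_nonneg.2 hδ.2.le))) hρ
  have hG : 0 < 2 * Phi (Real.sqrt (a * ρ * C / e)) - 1 := by
    have hC := hA2.2.2.1
    have he0 := he.1
    have ha0 : 0 < a := by linarith
    exact two_mul_Phi_sub_one_pos (Real.sqrt_pos.2 (by positivity))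
  set G := 2 * Phi (Real.sqrt (a * ρ * C / e)) - 1
  obtain ⟨k1, k2, hk1, hk2, hk⟩ := hpe
  have hpn : ∀ᶠ n : ℕ in atTop, 0 < p n ∧ k1 / n ≤ p n ∧ (0 : ℝ) < n := by
    filter_upwards [hk, eventually_ge_atTop 1] with n h1 hn
    have hn' : (1 : ℝ) ≤ n := by exact_mod_cast hn
    have h2 : (n : ℝ)⁻¹ ≤ (n : ℝ) ^ (-e) := by
      rw [← Real.rpow_neg_one]
      exact Real.rpow_le_rpow_of_exponent_le hn' (by linarith)
    have h3 : k1 / n ≤ p n := by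
      rw [div_eq_mul_inv]
      exact (mul_le_mul_of_nonneg_left h2 hk1.le).trans h1.1
    exact ⟨lt_of_lt_of_le (by positivity) h3, h3, by linarith⟩
  have hb1p : Tendsto (fun n => b1 n / p n) atTop (nhds 0) := by
    have h1 : Tendsto (fun n : ℕ => (n : ℝ) * b1 n / k1) atTop (nhds 0) := by
      simpa using hb1.div_const k1
    refine squeeze_zero' ?_ ?_ h1
    · filter_upwards [hb1', hpn] with n h2 h3
      exact div_nonneg h2.1 h3.1.le
    · filter_upwards [hb1', hpn] with n h2 h3
      rw [div_le_div_iff₀ h3.1 hk1]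
      have h4 : k1 ≤ p n * n := (div_le_iff₀ h3.2.2).1 h3.2.1
      nlinarith [mul_le_mul_of_nonneg_left h4 h2.1]
  refine ⟨fun n => (b1 n / p n + b2 n) / G - 1, ?_, ?_⟩
  · have h := ((hb1p.add hb2).div_const G).sub_const 1
    rwa [zero_add, div_self hG.ne', sub_self] at h
  · filter_upwards [hb1', hb2', hpn] with n h1 h2 h3
    have hterm : ∀ i : Fin n, (1 - p n) * t1FB a K L π2 α p u n i +
        p n * t2FB a K L π2 α p u n i ≤ b1 n + p n * b2 n := by
      intro i
      have h4 : 0 ≤ t1FB a K L π2 α p u n i := ENNReal.toReal_nonneg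
      have h5 : (1 - p n) * t1FB a K L π2 α p u n i ≤ t1FB a K L π2 α p u n i :=
        mul_le_of_le_one_left h4 (by linarith [h3.1])
      have h6 := mul_le_mul_of_nonneg_left (h2 i) h3.1.le
      linarith [h1.2 i]
    calc RFB a K L π2 α p u n ≤ ∑ _i : Fin n, (b1 n + p n * b2 n) :=
          Finset.sum_le_sum fun i _ => hterm i
      _ = (n : ℝ) * p n * G * (1 + ((b1 n / p n + b2 n) / G - 1)) := by
          have hp0 := h3.1.ne'
          have hG0 := hG.ne'
          rw [Finset.sum_const, Finset.card_univ, Fintype.card_fin, nsmul_eq_mul]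
          field_simp
          ring
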